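/- arXiv:0907.5232 — 2 statements merged into one kernel-verified Lean document; each statement's English description precedes it below -/
import Mathlib

section
/- For every ε > 0 there exists a real x_0 > 1 such that for all real x ≥ x_0, (1/2 − ε)·x/log x < π(x) − π(x/2) < (1/2 + ε)·x/log x. -/
/-- `piR x` is the prime-counting function at a real argument: the number of primes `≤ ⌊x⌋`. -/
noncomputable def piR (x : ℝ) : ℕ := Nat.primeCounting ⌊x⌋₊

section FejerAveraging

open MeasureTheory Filter Topology Set

/-- The (unnormalised) Fejér kernel on the real line. -/
noncomputable def fejerKernel (x : ℝ) : ℝ := Real.sinc (x / 2) ^ 2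

lemma continuous_fejerKernel : Continuous fejerKernel := by
  unfold fejerKernel
  exact (Real.continuous_sinc.comp (continuous_id.div_const 2)).pow 2

lemma fejerKernel_nonneg (x : ℝ) : 0 ≤ fejerKernel x := sq_nonneg _

lemma fejerKernel_le (x : ℝ) : fejerKernel x ≤ 5 * (1 + x ^ 2)⁻¹ := by
  have h1 : fejerKernel x ≤ 1 := by
    unfold fejerKernel
    exact (sq_le_one_iff_abs_le_one _).2 (Real.abs_sinc_le_one _)
  have h2 : x ^ 2 * fejerKernel x ≤ 4 := by
    rcases eq_or_ne x 0 with rfl | hx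
    · simp
    · have h : x ^ 2 * fejerKernel x = 4 * Real.sin (x / 2) ^ 2 := by
        rw [fejerKernel, Real.sinc_of_ne_zero (by positivity)]
        field_simp
        ring
      rw [h]
      nlinarith [Real.sin_sq_le_one (x / 2)]
  rw [← div_eq_mul_inv, le_div_iff₀ (by positivity)]
  linarith

lemma integrable_fejerKernel : Integrable fejerKernel := by
  refine Integrable.mono' (integrable_inv_one_add_sq.const_mul 5)
    continuous_fejerKernel.aestronglyMeasurable (.of_forall fun x ↦ ?_)
  rw [Real.norm_of_nonneg (fejerKernel_nonneg x)]
  exact fejerKernel_le x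

lemma integral_fejerKernel_pos : 0 < ∫ x, fejerKernel x := by
  rw [integral_pos_iff_support_of_nonneg fejerKernel_nonneg integrable_fejerKernel]
  exact continuous_fejerKernel.isOpen_support.measure_pos _ ⟨0, by simp [fejerKernel]⟩

/-- The Fejér kernel is the Fourier transform of the triangle function. -/
lemma integral_triangle_mul_exp (x : ℝ) :
    ∫ y in (-1 : ℝ)..1, ((1 - |y| : ℝ) : ℂ) * Complex.exp (Complex.I * x * y) =
      (fejerKernel x : ℂ) := by
  have hint (a b : ℝ) : IntervalIntegrable
      (fun y : ℝ ↦ ((1 - |y| : ℝ) : ℂ) * Complex.exp (Complex.I * x * y)) volume a b := by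
    apply Continuous.intervalIntegrable
    fun_prop
  rw [← intervalIntegral.integral_add_adjacent_intervals (hint (-1) 0) (hint 0 1)]
  have hneg : ∫ y in (-1 : ℝ)..0, ((1 - |y| : ℝ) : ℂ) * Complex.exp (Complex.I * x * y) =
      ∫ y in (-1 : ℝ)..0, (1 + y : ℂ) * Complex.exp (Complex.I * x * y) := by
    refine intervalIntegral.integral_congr fun y hy ↦ ?_
    rw [uIcc_of_le (by norm_num)] at hy
    simp [abs_of_nonpos hy.2]
  have hpos : ∫ y in (0 : ℝ)..1, ((1 - |y| : ℝ) : ℂ) * Complex.exp (Complex.I * x * y) =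
      ∫ y in (0 : ℝ)..1, (1 - y : ℂ) * Complex.exp (Complex.I * x * y) := by
    refine intervalIntegral.integral_congr fun y hy ↦ ?_
    rw [uIcc_of_le (by norm_num)] at hy
    simp [abs_of_nonneg hy.1]
  rw [hneg, hpos]
  set c : ℂ := Complex.I * x with hc
  rcases eq_or_ne x 0 with rfl | hx
  · have h1 : ∫ y in (-1 : ℝ)..0, (1 + y : ℂ) = ((∫ y in (-1 : ℝ)..0, (1 + y) : ℝ) : ℂ) := by
      rw [← intervalIntegral.integral_ofReal]; simp
    have h2 : ∫ y in (0 : ℝ)..1, (1 - y : ℂ) = ((∫ y in (0 : ℝ)..1, (1 - y) : ℝ) : ℂ) := by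
      rw [← intervalIntegral.integral_ofReal]; simp
    simp only [hc, Complex.ofReal_zero, mul_zero, zero_mul, Complex.exp_zero, mul_one]
    rw [h1, h2, intervalIntegral.integral_add (by simp) (by simp),
      intervalIntegral.integral_sub (by simp) (by simp)]
    norm_num [fejerKernel]
  · have hc0 : c ≠ 0 := by simp [hc, hx]
    have hexp (y : ℝ) : HasDerivAt (fun y : ℝ ↦ Complex.exp (c * y)) (Complex.exp (c * y) * c) y := by
      simpa using ((hasDerivAt_id y).ofReal_comp.const_mul c).cexp
    have h1 : ∫ y in (-1 : ℝ)..0, (1 + y : ℂ) * Complex.exp (c * y) =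
        Complex.exp (c * (0 : ℝ)) * ((1 + (0 : ℝ)) / c - 1 / c ^ 2)
          - Complex.exp (c * (-1 : ℝ)) * ((1 + (-1 : ℝ)) / c - 1 / c ^ 2) := by
      refine intervalIntegral.integral_eq_sub_of_hasDerivAt
        (f := fun y : ℝ ↦ Complex.exp (c * y) * ((1 + (y : ℂ)) / c - 1 / c ^ 2)) (fun y _ ↦ ?_)
        (Continuous.intervalIntegrable (by fun_prop) _ _)
      have hlin : HasDerivAt (fun y : ℝ ↦ (1 + (y : ℂ)) / c - 1 / c ^ 2) (1 / c) y := by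
        simpa using (((hasDerivAt_id y).ofReal_comp.const_add 1).div_const c).sub_const (1 / c ^ 2)
      convert! (hexp y).mul hlin using 1
      field_simp
      ring
    have h2 : ∫ y in (0 : ℝ)..1, (1 - y : ℂ) * Complex.exp (c * y) =
        Complex.exp (c * (1 : ℝ)) * ((1 - (1 : ℝ)) / c + 1 / c ^ 2)
          - Complex.exp (c * (0 : ℝ)) * ((1 - (0 : ℝ)) / c + 1 / c ^ 2) := by
      refine intervalIntegral.integral_eq_sub_of_hasDerivAt
        (f := fun y : ℝ ↦ Complex.exp (c * y) * ((1 - (y : ℂ)) / c + 1 / c ^ 2)) (fun y _ ↦ ?_)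
        (Continuous.intervalIntegrable (by fun_prop) _ _)
      have hlin : HasDerivAt (fun y : ℝ ↦ (1 - (y : ℂ)) / c + 1 / c ^ 2) (-1 / c) y := by
        simpa using (((hasDerivAt_id y).ofReal_comp.const_sub 1).div_const c).add_const (1 / c ^ 2)
      convert! (hexp y).mul hlin using 1
      field_simp
      ring
    have hcos : Complex.exp c + Complex.exp (-c) = 2 * Complex.cos x := by
      rw [Complex.cos, hc]
      ring_nf
    have hsin : (Complex.cos x : ℂ) = 1 - 2 * Complex.sin (x / 2) ^ 2 := by
      rw [show (x : ℂ) = 2 * (x / 2) by ring, Complex.cos_two_mul, Complex.cos_sq']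
      ring_nf
    have hx' : (x : ℂ) ≠ 0 := by exact_mod_cast hx
    have hc2 : c ^ 2 = - (x : ℂ) ^ 2 := by rw [hc, mul_pow, Complex.I_sq]; ring
    rw [h1, h2, fejerKernel, Real.sinc_of_ne_zero (by positivity)]
    push_cast
    simp only [mul_zero, mul_one, Complex.exp_zero, mul_neg]
    have : (1 : ℂ) * ((1 + 0) / c - 1 / c ^ 2) - Complex.exp (-c) * ((1 + -1) / c - 1 / c ^ 2) +
        (Complex.exp c * ((1 - 1) / c + 1 / c ^ 2) - 1 * ((1 - 0) / c + 1 / c ^ 2)) =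
        ((Complex.exp c + Complex.exp (-c)) - 2) / c ^ 2 := by
      field_simp
      ring
    rw [this, hcos, hsin, hc2]
    field_simp
    ring

/-- If the Fejér averages of a bounded function tend to `0` at every scale, the function
cannot stay above a positive constant on long intervals of fixed length. -/
lemma eventually_exists_lt_of_tendsto_fejer {H : ℝ → ℝ} {M : ℝ} (hH : Measurable H)
    (hM : ∀ t, |H t| ≤ M)
    (hlim : ∀ l : ℝ, 0 < l →
      Tendsto (fun u ↦ ∫ t, H t * fejerKernel (l * (u - t))) atTop (𝓝 0))
    {η δ : ℝ} (hη : 0 < η) (hδ : 0 < δ) :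
    ∀ᶠ u in atTop, ∃ t ∈ Icc (u - δ) (u + δ), H t < η := by
  set c := ∫ x, fejerKernel x
  have hc : 0 < c := integral_fejerKernel_pos
  have hM0 : 0 ≤ M := (abs_nonneg _).trans (hM 0)
  have htail : Tendsto (fun R : ℝ ↦ η * c - (η + M) * (c - ∫ s in Icc (-R) R, fejerKernel s))
      atTop (𝓝 (η * c - (η + M) * (c - c))) :=
    (((aecover_Icc tendsto_neg_atTop_atBot tendsto_id).integral_tendsto_of_countably_generated
      integrable_fejerKernel).const_sub c |>.const_mul _).const_sub _
  have hηc : 0 < η * c - (η + M) * (c - c) := by simpa using mul_pos hη hc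
  obtain ⟨R, hκpos, hR⟩ := ((htail.eventually (lt_mem_nhds hηc)).and (eventually_gt_atTop 0)).exists
  set l := R / δ
  have hl : 0 < l := by positivity
  set κ := η * c - (η + M) * (c - ∫ s in Icc (-R) R, fejerKernel s)
  filter_upwards [(hlim l hl).eventually (gt_mem_nhds (mul_pos (inv_pos.2 hl) hκpos))] with u hu
  by_contra! hcon
  refine hu.not_ge ?_
  have hsub : ∫ t, H t * fejerKernel (l * (u - t)) =
      l⁻¹ * ∫ s, H (u - s / l) * fejerKernel s := by
    rw [← integral_sub_left_eq_self _ volume u]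
    have := Measure.integral_comp_mul_left (fun s ↦ H (u - s / l) * fejerKernel s) l
    rw [abs_of_pos (inv_pos.2 hl), smul_eq_mul] at this
    rw [← this]
    congr with x
    rw [mul_div_cancel_left₀ _ hl.ne', sub_sub_cancel]
  rw [hsub]
  gcongr
  have hind : IntegrableOn fejerKernel (Icc (-R) R) := integrable_fejerKernel.integrableOn
  have hκ : κ = ∫ s, ((η + M) * (Icc (-R) R).indicator fejerKernel s - M * fejerKernel s) := by
    rw [integral_sub, integral_const_mul, integral_const_mul, integral_indicator measurableSet_Icc]
    · ring
    · exact (hind.integrable_indicator measurableSet_Icc).const_mul _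
    · exact integrable_fejerKernel.const_mul _
  rw [hκ]
  refine integral_mono (((hind.integrable_indicator measurableSet_Icc).const_mul _).sub
    (integrable_fejerKernel.const_mul _)) ?_ fun s ↦ ?_
  · refine integrable_fejerKernel.bdd_mul (c := M) ?_ (.of_forall fun s ↦ hM _)
    exact (hH.comp (by fun_prop)).aestronglyMeasurable
  · have hk := fejerKernel_nonneg s
    by_cases hs : s ∈ Icc (-R) R
    · simp only [indicator_of_mem hs]
      have h1 : s / l = δ * (s / R) := by simp only [l]; field_simp
      have h2 : |s / R| ≤ 1 := by
        rw [abs_div, abs_of_pos hR, div_le_one hR]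
        exact abs_le.2 hs
      have h3 := abs_le.1 h2
      have : η ≤ H (u - s / l) := hcon _ ⟨by rw [h1]; nlinarith, by rw [h1]; nlinarith⟩
      nlinarith
    · simp only [indicator_of_notMem hs]
      nlinarith [(abs_le.1 (hM (u - s / l))).1]

/-- A bounded function whose Fejér averages tend to `0` tends to `0` as soon as
`t ↦ (1 + H t) * exp t` is monotone. -/
lemma tendsto_zero_of_tendsto_fejer {H : ℝ → ℝ} {M : ℝ} (hH : Measurable H)
    (hM : ∀ t, |H t| ≤ M) {T : ℝ}
    (hmono : ∀ s t, T ≤ s → s ≤ t → (1 + H s) * Real.exp s ≤ (1 + H t) * Real.exp t)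
    (hlim : ∀ l : ℝ, 0 < l →
      Tendsto (fun u ↦ ∫ t, H t * fejerKernel (l * (u - t))) atTop (𝓝 0)) :
    Tendsto H atTop (𝓝 0) := by
  have key {ε : ℝ} (hε : 0 < ε) (hε1 : ε ≤ 1) : ∀ᶠ u in atTop, |H u| ≤ ε := by
    obtain ⟨δ, hδexp, hδ⟩ : ∃ δ, Real.exp (2 * δ) < 1 + ε / 4 ∧ 0 < δ := by
      have h : Tendsto (fun δ : ℝ ↦ Real.exp (2 * δ)) (𝓝[>] 0) (𝓝 1) := by
        have : Continuous fun δ : ℝ ↦ Real.exp (2 * δ) := by fun_prop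
        simpa using (this.tendsto 0).mono_left nhdsWithin_le_nhds
      exact ((h.eventually (gt_mem_nhds (by linarith))).and self_mem_nhdsWithin).exists
    have h1 := eventually_exists_lt_of_tendsto_fejer hH hM hlim (half_pos hε) hδ
    have h2 := eventually_exists_lt_of_tendsto_fejer (H := -H) hH.neg (by simpa using hM)
      (fun l hl ↦ by simpa [integral_neg] using (hlim l hl).neg) (half_pos hε) hδ
    have h1' := (tendsto_atTop_add_const_right atTop δ tendsto_id).eventually h1
    have h2' := (tendsto_atTop_add_const_right atTop (-δ) tendsto_id).eventually h2
    filter_upwards [h1', h2', eventually_ge_atTop (T + 2 * δ)] with u hu1 hu2 huT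
    have hexp {s t : ℝ} (hst : t ≤ s + 2 * δ) : Real.exp t ≤ Real.exp s * (1 + ε / 4) :=
      calc Real.exp t ≤ Real.exp (s + 2 * δ) := Real.exp_le_exp.2 hst
        _ = Real.exp s * Real.exp (2 * δ) := Real.exp_add _ _
        _ ≤ _ := by gcongr
    rw [abs_le]
    constructor
    · obtain ⟨t, ⟨ht1, ht2⟩, ht⟩ := hu2
      simp only [id_eq, Pi.neg_apply] at ht1 ht2 ht
      by_contra! hcon
      have hm := hmono t u (by linarith) (by linarith)
      have he := hexp (s := t) (t := u) (by linarith)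
      have het := Real.exp_pos t
      have htu : Real.exp t ≤ Real.exp u := Real.exp_le_exp.2 (by linarith)
      rcases le_or_gt 0 (1 + H u) with h | h
      · have : (1 + H t) ≤ (1 + H u) * (1 + ε / 4) := by
          by_contra! h'
          nlinarith [mul_le_mul_of_nonneg_left he h, mul_lt_mul_of_pos_right h' het]
        nlinarith
      · nlinarith [mul_pos_of_neg_of_neg h (neg_lt_zero.2 (Real.exp_pos u))]
    · obtain ⟨t, ⟨ht1, ht2⟩, ht⟩ := hu1
      simp only [id_eq] at ht1 ht2 ht
      by_contra! hcon
      have hm := hmono u t (by linarith) (by linarith)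
      have he := hexp (s := u) (t := t) (by linarith)
      have heu := Real.exp_pos u
      have h3 : (1 + H t) * Real.exp t ≤ (1 + ε / 2) * (Real.exp u * (1 + ε / 4)) :=
        (mul_le_mul_of_nonneg_right (by linarith) (Real.exp_pos t).le).trans
          (mul_le_mul_of_nonneg_left he (by positivity))
      have h4 : (1 + ε) * Real.exp u < (1 + H u) * Real.exp u := by gcongr
      nlinarith [mul_pos hε heu, mul_pos (mul_pos hε hε) heu,
        mul_nonneg (mul_nonneg hε.le heu.le) (sub_nonneg.2 hε1)]
  rw [Metric.tendsto_nhds]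
  intro ε hε
  filter_upwards [key (ε := min (ε / 2) 1) (by positivity) (min_le_right _ _)] with u hu
  rw [Real.dist_0_eq_abs]
  linarith [min_le_left (ε / 2) 1]

/-- Fejér averages of a damped bounded function, in terms of its Laplace transform. -/
lemma integral_mul_exp_mul_fejerKernel {H : ℝ → ℝ} {M : ℝ} (hH : Measurable H)
    (hM : ∀ t, |H t| ≤ M) {σ : ℝ} (hσ : 0 < σ) (l u : ℝ) :
    ((∫ t in Ioi 0, H t * Real.exp (-(σ * t)) * fejerKernel (l * (u - t)) : ℝ) : ℂ) =
      ∫ y in (-1 : ℝ)..1, ((1 - |y| : ℝ) : ℂ) * Complex.exp (Complex.I * (l * u) * y) *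
        ∫ t in Ioi (0 : ℝ), (H t : ℂ) * Complex.exp (-((σ + Complex.I * (l * y)) * t)) := by
  rw [← integral_complex_ofReal]
  have h1 (t : ℝ) : ((H t * Real.exp (-(σ * t)) * fejerKernel (l * (u - t)) : ℝ) : ℂ) =
      ∫ y in Ioc (-1 : ℝ) 1, ((H t : ℂ) * Complex.exp (-(σ * t))) *
        (((1 - |y| : ℝ) : ℂ) * Complex.exp (Complex.I * (l * (u - t)) * y)) := by
    rw [integral_const_mul, ← intervalIntegral.integral_of_le (by norm_num)]
    have := integral_triangle_mul_exp (l * (u - t))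
    push_cast at this ⊢
    rw [this]
  have hint : Integrable (Function.uncurry fun t y : ℝ ↦
      ((H t : ℂ) * Complex.exp (-(σ * t))) *
        (((1 - |y| : ℝ) : ℂ) * Complex.exp (Complex.I * (l * (u - t)) * y)))
      ((volume.restrict (Ioi 0)).prod (volume.restrict (Ioc (-1) 1))) := by
    have hg : Integrable (fun t : ℝ ↦ M * Real.exp (-(σ * t))) (volume.restrict (Ioi 0)) := by
      simpa [neg_mul] using (integrableOn_exp_mul_Ioi (neg_lt_zero.2 hσ) 0).const_mul M
    have hy : Integrable (fun _ : ℝ ↦ (1 : ℝ)) (volume.restrict (Ioc (-1) 1)) := by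
      simp
    refine (hg.mul_prod hy).mono' ?_ ?_
    · refine Measurable.aestronglyMeasurable ?_
      refine Measurable.mul ?_ ?_
      · exact (Complex.measurable_ofReal.comp (hH.comp measurable_fst)).mul
          (Continuous.measurable (by fun_prop))
      · exact Continuous.measurable (by fun_prop)
    · rw [Measure.prod_restrict]
      filter_upwards [ae_restrict_mem (measurableSet_Ioi.prod measurableSet_Ioc)] with p hp
      obtain ⟨-, hp2⟩ := hp
      have e1 : ‖Complex.exp (-(σ * p.1))‖ = Real.exp (-(σ * p.1)) := by
        rw [Complex.norm_exp]; simp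
      have e2 : ‖Complex.exp (Complex.I * (l * (u - p.1)) * p.2)‖ = 1 := by
        rw [Complex.norm_exp]; simp
      have e3 : |1 - abs p.2| ≤ 1 := by
        have : |p.2| ≤ 1 := abs_le.2 ⟨hp2.1.le, hp2.2⟩
        rw [abs_le]
        constructor <;> linarith [abs_nonneg p.2]
      simp only [Function.uncurry, norm_mul, e1, e2, Complex.norm_real, Real.norm_eq_abs, mul_one]
      exact mul_le_mul_of_nonneg_right (hM _) (Real.exp_pos _).le |>.trans' <|
        mul_le_of_le_one_right (by positivity) e3
  calc ∫ t in Ioi 0, ((H t * Real.exp (-(σ * t)) * fejerKernel (l * (u - t)) : ℝ) : ℂ)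
    _ = _ := by
      simp_rw [h1]
      exact integral_integral_swap hint
    _ = _ := by
      rw [intervalIntegral.integral_of_le (by norm_num)]
      congr with y
      rw [← integral_const_mul]
      congr with t
      have : Complex.exp (-(σ * t)) * Complex.exp (Complex.I * (l * (u - t)) * y) =
          Complex.exp (Complex.I * (l * u) * y) *
            Complex.exp (-((σ + Complex.I * (l * y)) * t)) := by
        rw [← Complex.exp_add, ← Complex.exp_add]
        ring_nf
      linear_combination ((H t : ℂ) * ((1 - |y| : ℝ) : ℂ)) * this

/-- The Riemann-Lebesgue lemma on a compact interval. -/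
lemma tendsto_intervalIntegral_mul_exp (g : ℝ → ℂ) {l : ℝ} (hl : 0 < l) :
    Tendsto (fun u : ℝ ↦ ∫ y in (-1 : ℝ)..1, g y * Complex.exp (Complex.I * (l * u) * y))
      atTop (𝓝 0) := by
  have h := Real.tendsto_integral_exp_smul_cocompact ((Ioc (-1 : ℝ) 1).indicator g)
  have hu : Tendsto (fun u : ℝ ↦ -(l / (2 * Real.pi)) * u) atTop (cocompact ℝ) :=
    (tendsto_id.const_mul_atTop_of_neg (by have := Real.pi_pos; simp; positivity)).mono_right
      atBot_le_cocompact
  refine (h.comp hu).congr fun u ↦ ?_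
  rw [intervalIntegral.integral_of_le (by norm_num), ← integral_indicator measurableSet_Ioc]
  refine integral_congr_ae (.of_forall fun y ↦ ?_)
  by_cases hy : y ∈ Ioc (-1 : ℝ) 1
  · simp only [indicator_of_mem hy, Circle.smul_def, Real.fourierChar_apply, smul_eq_mul]
    rw [mul_comm]
    congr 2
    push_cast
    have : (Real.pi : ℂ) ≠ 0 := by exact_mod_cast Real.pi_ne_zero
    field_simp
  · simp [indicator_of_notMem hy]

/-- If the Laplace transform of a bounded function extends continuously to the closed right
half-plane, then all its Fejér averages tend to `0`. -/
lemma tendsto_fejer_of_laplace {H : ℝ → ℝ} {M : ℝ} (hH : Measurable H)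
    (hM : ∀ t, |H t| ≤ M) {A : ℂ → ℂ} (hA : ContinuousOn A {s | 0 ≤ s.re})
    (hlap : ∀ s : ℂ, 0 < s.re → ∫ t in Ioi (0 : ℝ), (H t : ℂ) * Complex.exp (-(s * t)) = A s)
    {l : ℝ} (hl : 0 < l) :
    Tendsto (fun u ↦ ∫ t in Ioi 0, H t * fejerKernel (l * (u - t))) atTop (𝓝 0) := by
  have hlim (u : ℝ) : ((∫ t in Ioi 0, H t * fejerKernel (l * (u - t)) : ℝ) : ℂ) =
      ∫ y in (-1 : ℝ)..1, (((1 - |y| : ℝ) : ℂ) * A (Complex.I * (l * y))) *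
        Complex.exp (Complex.I * (l * u) * y) := by
    have hk : Integrable (fun t ↦ fejerKernel (l * (u - t))) :=
      (integrable_fejerKernel.comp_mul_left' hl.ne').comp_sub_left u
    have hleft : Tendsto (fun σ : ℝ ↦
        ∫ t in Ioi 0, H t * Real.exp (-(σ * t)) * fejerKernel (l * (u - t))) (𝓝[>] 0)
        (𝓝 (∫ t in Ioi 0, H t * fejerKernel (l * (u - t)))) := by
      refine tendsto_integral_filter_of_dominated_convergence
        (fun t ↦ M * fejerKernel (l * (u - t))) ?_ ?_ (hk.const_mul M).integrableOn ?_
      · refine .of_forall fun σ ↦ Measurable.aestronglyMeasurable ?_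
        exact (hH.mul (by fun_prop)).mul (continuous_fejerKernel.measurable.comp (by fun_prop))
      · filter_upwards [self_mem_nhdsWithin] with σ hσ
        filter_upwards [ae_restrict_mem measurableSet_Ioi] with t ht
        rw [norm_mul, norm_mul, Real.norm_of_nonneg (fejerKernel_nonneg _),
          Real.norm_of_nonneg (Real.exp_pos _).le, Real.norm_eq_abs]
        have h1 : Real.exp (-(σ * t)) ≤ 1 :=
          Real.exp_le_one_iff.2 (neg_nonpos.2 (mul_pos hσ ht).le)
        have := fejerKernel_nonneg (l * (u - t))
        gcongr
        exact (mul_le_of_le_one_right (abs_nonneg _) h1).trans (hM t)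
      · refine .of_forall fun t ↦ ?_
        have hc : Continuous fun σ : ℝ ↦ H t * Real.exp (-(σ * t)) * fejerKernel (l * (u - t)) := by
          fun_prop
        simpa using (hc.tendsto 0).mono_left nhdsWithin_le_nhds
    have hAc : Continuous fun p : ℝ × ℝ ↦ A ((max p.1 0 : ℝ) + Complex.I * (l * p.2)) :=
      hA.comp_continuous (by fun_prop) fun p ↦ by simp
    have hcont : Continuous fun σ : ℝ ↦ ∫ y in (-1 : ℝ)..1,
        ((1 - |y| : ℝ) : ℂ) * Complex.exp (Complex.I * (l * u) * y) *
          A ((max σ 0 : ℝ) + Complex.I * (l * y)) := by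
      refine intervalIntegral.continuous_parametric_intervalIntegral_of_continuous' ?_ _ _
      exact Continuous.mul (by fun_prop) hAc
    have hright := (hcont.tendsto 0).mono_left (nhdsWithin_le_nhds (s := Ioi 0))
    have hleft' := (Complex.continuous_ofReal.tendsto _).comp hleft
    refine (tendsto_nhds_unique (hleft'.congr' ?_) hright).trans ?_
    · filter_upwards [self_mem_nhdsWithin] with σ (hσ : 0 < σ)
      simp only [Function.comp_apply]
      rw [integral_mul_exp_mul_fejerKernel hH hM hσ]
      refine intervalIntegral.integral_congr fun y _ ↦ ?_
      rw [hlap _ (by simpa using hσ), max_eq_left hσ.le]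
    · refine intervalIntegral.integral_congr fun y _ ↦ ?_
      simp
      ring
  have h := tendsto_intervalIntegral_mul_exp
    (fun y ↦ ((1 - |y| : ℝ) : ℂ) * A (Complex.I * (l * y))) hl
  simp_rw [← hlim] at h
  simpa only [Function.comp_def, Complex.ofReal_re, Complex.zero_re] using
    (Complex.continuous_re.tendsto 0).comp h

/-- A Tauberian theorem of Wiener-Ikehara type for bounded functions. -/
theorem tendsto_zero_of_laplace {H : ℝ → ℝ} {M : ℝ} (hH : Measurable H)
    (hM : ∀ t, |H t| ≤ M)
    (hmono : ∀ s t, s ≤ t → (1 + H s) * Real.exp s ≤ (1 + H t) * Real.exp t)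
    {A : ℂ → ℂ} (hA : ContinuousOn A {s | 0 ≤ s.re})
    (hlap : ∀ s : ℂ, 0 < s.re → ∫ t in Ioi (0 : ℝ), (H t : ℂ) * Complex.exp (-(s * t)) = A s) :
    Tendsto H atTop (𝓝 0) := by
  have hpos : ∀ t ∈ Ioi (0 : ℝ), (Ioi (0 : ℝ)).indicator H t = H t := fun t ht ↦
    indicator_of_mem ht _
  have h := tendsto_zero_of_tendsto_fejer (H := (Ioi 0).indicator H) (M := M) (T := 1)
    (hH.indicator measurableSet_Ioi) (fun t ↦ ?_) (fun s t hs hst ↦ ?_) fun l hl ↦ ?_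
  · refine h.congr' ?_
    filter_upwards [eventually_gt_atTop 0] with t ht using hpos t ht
  · exact (norm_indicator_le_norm_self H t).trans (hM t)
  · rw [hpos s (by simp; linarith), hpos t (by simp; linarith)]
    exact hmono s t hst
  · refine (tendsto_fejer_of_laplace hH hM hA hlap hl).congr fun u ↦ ?_
    rw [← integral_indicator measurableSet_Ioi]
    congr with t
    rw [indicator_mul_left]

end FejerAveraging

section PrimeNumberTheorem

open MeasureTheory Filter Topology Set Asymptotics
open ArithmeticFunction.vonMangoldt

/-- The function `(L Λ s - 1 / (s - 1) - 1) / s`, extended continuously to `1 ≤ re s` and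
translated by `1`: the Laplace transform of `t ↦ ψ (exp t) / exp t - 1`. -/
noncomputable def psiLaplace (s : ℂ) : ℂ :=
  (LFunctionResidueClassAux (1 : ZMod 1) (s + 1) - 1) / (s + 1)

lemma continuousOn_psiLaplace : ContinuousOn psiLaplace {s | 0 ≤ s.re} := by
  unfold psiLaplace
  refine ContinuousOn.div (ContinuousOn.sub ?_ continuousOn_const) (by fun_prop) fun s hs h ↦ ?_
  · exact (continuousOn_LFunctionResidueClassAux (1 : ZMod 1)).comp (by fun_prop)
      fun s (hs : 0 ≤ s.re) ↦ by simpa using hs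
  · have := congrArg Complex.re h
    simp only [mem_ofPred_eq, Complex.add_re, Complex.one_re, Complex.zero_re] at hs this
    linarith

lemma LSeries_vonMangoldt_eq {s : ℂ} (hs : 0 < s.re) :
    LSeries (fun n ↦ (Λ n : ℂ)) (s + 1) =
      LFunctionResidueClassAux (1 : ZMod 1) (s + 1) + 1 / s := by
  have h := eqOn_LFunctionResidueClassAux (q := 1) (a := 1) isUnit_one
    (show s + 1 ∈ {s : ℂ | 1 < s.re} by simpa using hs)
  have hres : residueClass (1 : ZMod 1) = Λ := by
    ext n
    simp [residueClass, Subsingleton.elim (n : ZMod 1) 1]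
  rw [h, hres]
  simp

lemma integral_psi_mul_exp {s : ℂ} (hs : 0 < s.re) :
    ∫ t in Ioi (0 : ℝ), (Chebyshev.psi (Real.exp t) * Real.exp (-t) : ℝ) * Complex.exp (-(s * t)) =
      LSeries (fun n ↦ (Λ n : ℂ)) (s + 1) / (s + 1) := by
  have hs1 : s + 1 ≠ 0 := fun h ↦ by
    have := congrArg Complex.re h
    simp only [Complex.add_re, Complex.one_re, Complex.zero_re] at this
    linarith
  have hO : (fun n : ℕ ↦ ∑ k ∈ Finset.Icc 1 n, Λ k) =O[atTop] fun n ↦ (n : ℝ) ^ (1 : ℝ) := by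
    refine .of_bound (Real.log 4 + 4) (.of_forall fun n ↦ ?_)
    have h : ∑ k ∈ Finset.Icc 1 n, Λ k = Chebyshev.psi n := by
      simp [Chebyshev.psi, ← Finset.Icc_add_one_left_eq_Ioc]
    rw [h, Real.rpow_one, Real.norm_of_nonneg (Chebyshev.psi_nonneg _),
      Real.norm_of_nonneg (by positivity)]
    exact Chebyshev.psi_le_const_mul_self (by positivity)
  rw [LSeries_eq_mul_integral_of_nonneg _ zero_le_one (by simpa using hs) hO
    fun _ ↦ ArithmeticFunction.vonMangoldt_nonneg, mul_div_cancel_left₀ _ hs1]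
  have himage : Real.exp '' Ioi 0 = Ioi 1 := by
    ext x
    constructor
    · rintro ⟨t, ht, rfl⟩
      exact Real.one_lt_exp_iff.2 ht
    · intro hx
      exact ⟨Real.log x, Real.log_pos hx, Real.exp_log (zero_lt_one.trans hx)⟩
  rw [← himage, integral_image_eq_integral_abs_deriv_smul measurableSet_Ioi
    (fun t _ ↦ (Real.hasDerivAt_exp t).hasDerivWithinAt) Real.exp_injective.injOn]
  refine integral_congr_ae (.of_forall fun t ↦ ?_)
  have hpow : ((Real.exp t : ℝ) : ℂ) ^ (-(s + 1 + 1)) = Complex.exp (-((s + 1 + 1) * t)) := by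
    rw [Complex.cpow_def_of_ne_zero (by exact_mod_cast (Real.exp_pos t).ne'),
      ← Complex.ofReal_log (Real.exp_pos t).le, Real.log_exp]
    ring_nf
  have hsum : ∑ k ∈ Finset.Icc 1 ⌊Real.exp t⌋₊, (Λ k : ℂ) = (Chebyshev.psi (Real.exp t) : ℂ) := by
    simp [Chebyshev.psi, ← Finset.Icc_add_one_left_eq_Ioc]
  have hexp : Complex.exp (-t) * Complex.exp (-(s * t)) =
      Complex.exp t * Complex.exp (-((s + 1 + 1) * t)) := by
    rw [← Complex.exp_add, ← Complex.exp_add]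
    ring_nf
  simp only [hpow, hsum, abs_of_pos (Real.exp_pos t), Complex.real_smul]
  push_cast
  linear_combination (Chebyshev.psi (Real.exp t) : ℂ) * hexp

lemma psi_exp_mul_exp_neg_mem_Icc (t : ℝ) :
    Chebyshev.psi (Real.exp t) * Real.exp (-t) ∈ Icc 0 (Real.log 4 + 4) := by
  refine ⟨mul_nonneg (Chebyshev.psi_nonneg _) (Real.exp_pos _).le, ?_⟩
  calc Chebyshev.psi (Real.exp t) * Real.exp (-t)
    _ ≤ (Real.log 4 + 4) * Real.exp t * Real.exp (-t) := by
      gcongr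
      exact Chebyshev.psi_le_const_mul_self (Real.exp_pos t).le
    _ = _ := by rw [mul_assoc, ← Real.exp_add]; simp

/-- The **prime number theorem** for the Chebyshev function `ψ`, in exponential scale. -/
lemma tendsto_psi_exp_mul_exp_neg :
    Tendsto (fun t : ℝ ↦ Chebyshev.psi (Real.exp t) * Real.exp (-t) - 1) atTop (𝓝 0) := by
  have hmeas : Measurable fun t : ℝ ↦ Chebyshev.psi (Real.exp t) * Real.exp (-t) :=
    (Chebyshev.psi_mono.measurable.comp Real.measurable_exp).mul (by fun_prop)
  have hlog : 0 ≤ Real.log 4 := Real.log_nonneg (by norm_num)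
  refine tendsto_zero_of_laplace (M := Real.log 4 + 4) (hmeas.sub_const 1) (fun t ↦ ?_)
    (fun s t hst ↦ ?_) continuousOn_psiLaplace fun s hs ↦ ?_
  · have h := psi_exp_mul_exp_neg_mem_Icc t
    rw [abs_le]
    constructor <;> linarith [h.1, h.2]
  · have h (t : ℝ) : (1 + (Chebyshev.psi (Real.exp t) * Real.exp (-t) - 1)) * Real.exp t =
        Chebyshev.psi (Real.exp t) := by
      rw [add_sub_cancel, mul_assoc, ← Real.exp_add]
      simp
    rw [h, h]
    exact Chebyshev.psi_mono (Real.exp_le_exp.2 hst)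
  · have hexp_int : IntegrableOn (fun t : ℝ ↦ Complex.exp (-(s * t))) (Ioi 0) := by
      simpa [neg_mul] using integrableOn_exp_mul_complex_Ioi (a := -s) (by simpa using hs) 0
    have hpsi_int : IntegrableOn (fun t : ℝ ↦
        ((Chebyshev.psi (Real.exp t) * Real.exp (-t) : ℝ) : ℂ) * Complex.exp (-(s * t)))
        (Ioi 0) := by
      refine hexp_int.bdd_mul (c := Real.log 4 + 4)
        (Complex.measurable_ofReal.comp hmeas).aestronglyMeasurable (.of_forall fun t ↦ ?_)
      have h := psi_exp_mul_exp_neg_mem_Icc t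
      rw [Complex.norm_real, Real.norm_of_nonneg h.1]
      exact h.2
    have hexp_eq : ∫ t in Ioi (0 : ℝ), Complex.exp (-(s * t)) = 1 / s := by
      have := integral_exp_mul_complex_Ioi (a := -s) (by simpa using hs) 0
      simpa [neg_mul] using this
    have hs0 : s ≠ 0 := fun h ↦ by simp [h] at hs
    have hs1 : s + 1 ≠ 0 := fun h ↦ by
      have := congrArg Complex.re h
      simp only [Complex.add_re, Complex.one_re, Complex.zero_re] at this
      linarith
    simp_rw [Complex.ofReal_sub, Complex.ofReal_one, sub_mul, one_mul]
    rw [integral_sub hpsi_int hexp_int, integral_psi_mul_exp hs, hexp_eq,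
      LSeries_vonMangoldt_eq hs, psiLaplace]
    field_simp
    ring

/-- The **prime number theorem** for the Chebyshev function `ψ`. -/
theorem tendsto_psi_div_self : Tendsto (fun x : ℝ ↦ Chebyshev.psi x / x) atTop (𝓝 1) := by
  have h := (tendsto_psi_exp_mul_exp_neg.comp Real.tendsto_log_atTop).add_const 1
  rw [zero_add] at h
  refine h.congr' ?_
  filter_upwards [eventually_gt_atTop 0] with x hx
  simp [Real.exp_neg, Real.exp_log hx, div_eq_mul_inv]

/-- The **prime number theorem** for the Chebyshev function `θ`. -/
theorem tendsto_theta_div_self : Tendsto (fun x : ℝ ↦ Chebyshev.theta x / x) atTop (𝓝 1) := by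
  have hsqrt : (fun x : ℝ ↦ √x) =o[atTop] fun x ↦ x := by
    refine (isLittleO_iff_tendsto' ?_).2 ?_
    · filter_upwards [eventually_gt_atTop 0] with x hx h using absurd h hx.ne'
    · simp_rw [Real.sqrt_div_self', one_div]
      exact Real.tendsto_sqrt_atTop.inv_tendsto_atTop
  have h := (Chebyshev.isBigO_psi_sub_theta_sqrt.trans_isLittleO hsqrt).tendsto_div_nhds_zero
  have h' := tendsto_psi_div_self.sub h
  rw [sub_zero] at h'
  refine h'.congr fun x ↦ ?_
  rw [Pi.sub_apply]
  ring

/-- The **prime number theorem**. -/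
theorem tendsto_primeCounting_mul_log_div :
    Tendsto (fun x : ℝ ↦ (Nat.primeCounting ⌊x⌋₊ : ℝ) * Real.log x / x) atTop (𝓝 1) := by
  have h1 : Tendsto (fun x : ℝ ↦ (∫ t in 2..x, Chebyshev.theta t / (t * Real.log t ^ 2)) /
      (x / Real.log x)) atTop (𝓝 0) :=
    Chebyshev.integral_theta_div_log_sq_isLittleO.tendsto_div_nhds_zero
  have h2 := tendsto_theta_div_self.add h1
  rw [add_zero] at h2
  refine h2.congr' ?_
  filter_upwards [eventually_ge_atTop 2] with x hx
  have hlog : Real.log x ≠ 0 := (Real.log_pos (by linarith)).ne'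
  have hx0 : x ≠ 0 := by linarith
  rw [Chebyshev.primeCounting_eq_theta_div_log_add_integral hx]
  field_simp

lemma tendsto_log_div_log_half :
    Tendsto (fun x : ℝ ↦ Real.log x / Real.log (x / 2)) atTop (𝓝 1) := by
  have hhalf : Tendsto (fun x : ℝ ↦ x / 2) atTop atTop := tendsto_id.atTop_div_const two_pos
  have hlog := Real.tendsto_log_atTop.comp hhalf
  have h := (hlog.inv_tendsto_atTop.const_mul (Real.log 2)).const_add 1
  rw [mul_zero, add_zero] at h
  refine h.congr' ?_
  filter_upwards [hlog.eventually_gt_atTop 0, eventually_gt_atTop 0] with x hx hx0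
  simp only [Function.comp_apply, Pi.inv_apply] at hx ⊢
  have : Real.log x = Real.log (x / 2) + Real.log 2 := by
    rw [Real.log_div hx0.ne' two_ne_zero]
    ring
  rw [this]
  field_simp

end PrimeNumberTheorem

theorem pi_sub_pi_half_asymptotic (ε : ℝ) (hε : 0 < ε) :
    ∃ x₀ : ℝ, 1 < x₀ ∧ ∀ x : ℝ, x₀ ≤ x →
      (1 / 2 - ε) * x / Real.log x < (piR x : ℝ) - piR (x / 2) ∧
        (piR x : ℝ) - piR (x / 2) < (1 / 2 + ε) * x / Real.log x := by
  have hhalf : Filter.Tendsto (fun x : ℝ ↦ x / 2) Filter.atTop Filter.atTop :=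
    Filter.tendsto_id.atTop_div_const two_pos
  have h := tendsto_primeCounting_mul_log_div.sub
    (((tendsto_primeCounting_mul_log_div.comp hhalf).mul tendsto_log_div_log_half).div_const 2)
  have hlim : Filter.Tendsto (fun x : ℝ ↦ ((piR x : ℝ) - piR (x / 2)) * Real.log x / x)
      Filter.atTop (nhds (1 / 2)) := by
    rw [show (1 : ℝ) - 1 * 1 / 2 = 1 / 2 by norm_num] at h
    refine h.congr' ?_
    filter_upwards [Filter.eventually_gt_atTop 2] with x hx
    have hlog : Real.log (x / 2) ≠ 0 := (Real.log_pos (by linarith)).ne'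
    have hx0 : x ≠ 0 := by linarith
    simp only [Function.comp_apply, piR]
    field_simp
  have hlow := hlim.eventually (lt_mem_nhds (show 1 / 2 - ε < 1 / 2 by linarith))
  have hupp := hlim.eventually (gt_mem_nhds (show 1 / 2 < 1 / 2 + ε by linarith))
  obtain ⟨N, hN⟩ := Filter.eventually_atTop.1 (hlow.and hupp)
  refine ⟨max N 2, by simp, fun x hx ↦ ?_⟩
  have hx2 : 2 ≤ x := (le_max_right _ _).trans hx
  have hlog : 0 < Real.log x := Real.log_pos (by linarith)
  have hx0 : 0 < x := by linarith
  obtain ⟨h1, h2⟩ := hN x ((le_max_left _ _).trans hx)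
  rw [lt_div_iff₀ hx0] at h1
  rw [div_lt_iff₀ hx0] at h2
  exact ⟨(div_lt_iff₀ hlog).2 h1, (lt_div_iff₀ hlog).2 h2⟩
end

section
/- For all real x > 2^24, the inequality π(x/2) < (2/3)·x/log x holds. -/
open ArithmeticFunction.vonMangoldt in
/-- Legendre's formula for `log n!`, summed up to any bound `M ≥ n`. -/
theorem log_factorial_eq_sum_vonMangoldt {n M : ℕ} (h : n ≤ M) :
    Real.log n.factorial = ∑ d ∈ Finset.Ioc 0 M, Λ d * ((n / d : ℕ) : ℝ) := by
  induction n with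
  | zero => simp
  | succ n ih =>
    have hdiv : Real.log ((n + 1 : ℕ) : ℝ) =
        ∑ d ∈ Finset.Ioc 0 M, if d ∣ n + 1 then Λ d else 0 := by
      rw [← ArithmeticFunction.vonMangoldt_sum, ← Finset.sum_filter]
      refine Finset.sum_congr ?_ fun _ _ => rfl
      ext d
      simp only [Nat.mem_divisors, Finset.mem_filter, Finset.mem_Ioc]
      refine ⟨fun hd => ⟨⟨Nat.pos_of_dvd_of_pos hd.1 n.succ_pos,
        (Nat.le_of_dvd n.succ_pos hd.1).trans h⟩, hd.1⟩, fun hd => ⟨hd.2, n.succ_ne_zero⟩⟩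
    rw [Nat.factorial_succ, Nat.cast_mul, Real.log_mul (by positivity) (by positivity), hdiv,
      ih (by omega), ← Finset.sum_add_distrib]
    refine Finset.sum_congr rfl fun d _ => ?_
    rw [Nat.succ_div]
    split_ifs <;> push_cast <;> ring

theorem log_factorial_le {n : ℕ} (hn : 1 ≤ n) :
    Real.log n.factorial ≤ n * Real.log n - n + 1 + Real.log n := by
  induction n, hn using Nat.le_induction with
  | base => simp
  | succ n hn ih =>
    have hn' : (0 : ℝ) < n := by exact_mod_cast hn
    rw [Nat.factorial_succ, Nat.cast_mul, Real.log_mul (by positivity) (by positivity)]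
    have h := Real.one_sub_inv_le_log_of_pos (x := ((n : ℝ) + 1) / n) (by positivity)
    rw [Real.log_div (by positivity) (by positivity), inv_div] at h
    have h2 : 1 - (n : ℝ) / (n + 1) = 1 / (n + 1) := by field_simp; ring
    rw [h2, div_le_iff₀ (by positivity)] at h
    push_cast
    nlinarith

theorem le_log_factorial {n : ℕ} (hn : 1 ≤ n) :
    n * Real.log n - n + 1 ≤ Real.log n.factorial := by
  induction n, hn using Nat.le_induction with
  | base => simp
  | succ n hn ih =>
    have hn' : (0 : ℝ) < n := by exact_mod_cast hn
    rw [Nat.factorial_succ, Nat.cast_mul, Real.log_mul (by positivity) (by positivity)]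
    have h := Real.log_le_sub_one_of_pos (x := ((n : ℝ) + 1) / n) (by positivity)
    rw [Real.log_div (by positivity) (by positivity)] at h
    have h2 : ((n : ℝ) + 1) / n - 1 = 1 / n := by field_simp; ring
    rw [h2, le_div_iff₀ hn'] at h
    push_cast
    nlinarith

theorem log_factorial_floor_le {y : ℝ} (hy : 1 ≤ y) :
    Real.log (⌊y⌋₊.factorial) ≤ y * Real.log y - y + 1 + Real.log y := by
  have hn : 1 ≤ ⌊y⌋₊ := Nat.one_le_floor_iff y |>.2 hy
  have hle : (⌊y⌋₊ : ℝ) ≤ y := Nat.floor_le (by linarith)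
  refine (log_factorial_le hn).trans ?_
  generalize ⌊y⌋₊ = n at *
  have hn' : (1 : ℝ) ≤ n := by exact_mod_cast hn
  have h := Real.one_sub_inv_le_log_of_pos (x := y / n) (by positivity)
  rw [Real.log_div (by positivity) (by positivity), inv_div, sub_le_iff_le_add] at h
  have h2 : y ≤ y * (Real.log y - Real.log n) + n := by
    have := mul_le_mul_of_nonneg_left h (by linarith : 0 ≤ y)
    rwa [mul_add, mul_div_cancel₀ _ (by positivity), mul_one] at this
  have h3 : 0 ≤ (y - n) * Real.log n := mul_nonneg (by linarith) (Real.log_nonneg hn')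
  have h4 : Real.log n ≤ Real.log y := Real.log_le_log (by positivity) hle
  nlinarith

theorem le_log_factorial_floor {y : ℝ} (hy : 1 ≤ y) :
    y * Real.log y - y + 1 - Real.log y ≤ Real.log (⌊y⌋₊.factorial) := by
  have hn : 1 ≤ ⌊y⌋₊ := Nat.one_le_floor_iff y |>.2 hy
  have hle : (⌊y⌋₊ : ℝ) ≤ y := Nat.floor_le (by linarith)
  have hlt : y < ⌊y⌋₊ + 1 := Nat.lt_floor_add_one y
  refine le_trans ?_ (le_log_factorial hn)
  generalize ⌊y⌋₊ = n at *
  have hn' : (1 : ℝ) ≤ n := by exact_mod_cast hn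
  have h := Real.log_le_sub_one_of_pos (x := y / n) (by positivity)
  rw [Real.log_div (by positivity) (by positivity)] at h
  have h2 : n * (Real.log y - Real.log n) ≤ y - n := by
    have := mul_le_mul_of_nonneg_left h (by linarith : (0 : ℝ) ≤ n)
    rwa [mul_sub, mul_sub, mul_div_cancel₀ _ (by positivity), mul_one, ← mul_sub] at this
  have h3 : 0 ≤ (1 - (y - n)) * Real.log y := mul_nonneg (by linarith) (Real.log_nonneg hy)
  nlinarith

open Chebyshev ArithmeticFunction.vonMangoldt in
/-- Chebyshev's comparison of `ψ(N) - ψ(N/6)` with `log (N! (N/30)! / ((N/2)! (N/3)! (N/5)!))`. -/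
theorem psi_sub_psi_div_six_le_log_factorial (N : ℕ) :
    ψ (N : ℝ) - ψ ((N / 6 : ℕ) : ℝ) ≤
      Real.log N.factorial - Real.log (N / 2).factorial - Real.log (N / 3).factorial
        - Real.log (N / 5).factorial + Real.log (N / 30).factorial := by
  rw [log_factorial_eq_sum_vonMangoldt (le_refl N),
    log_factorial_eq_sum_vonMangoldt (Nat.div_le_self N 2),
    log_factorial_eq_sum_vonMangoldt (Nat.div_le_self N 3),
    log_factorial_eq_sum_vonMangoldt (Nat.div_le_self N 5),
    log_factorial_eq_sum_vonMangoldt (Nat.div_le_self N 30),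
    ← Finset.sum_sub_distrib, ← Finset.sum_sub_distrib, ← Finset.sum_sub_distrib,
    ← Finset.sum_add_distrib]
  have hψ : ψ ((N / 6 : ℕ) : ℝ) = ∑ d ∈ Finset.Ioc 0 N, if d ≤ N / 6 then Λ d else 0 := by
    rw [psi, Nat.floor_natCast, ← Finset.sum_filter]
    refine Finset.sum_congr ?_ fun _ _ => rfl
    ext d
    simp only [Finset.mem_filter, Finset.mem_Ioc]
    have := Nat.div_le_self N 6
    omega
  rw [hψ, psi, Nat.floor_natCast, ← Finset.sum_sub_distrib]
  refine Finset.sum_le_sum fun d hd => ?_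
  obtain ⟨hd0, hdN⟩ := Finset.mem_Ioc.1 hd
  have hΛ : 0 ≤ Λ d := ArithmeticFunction.vonMangoldt_nonneg
  have key : (if d ≤ N / 6 then 0 else 1) + N / d / 2 + N / d / 3 + N / d / 5
      ≤ N / d + N / d / 30 := by
    have h1 : 1 ≤ N / d := (Nat.one_le_div_iff hd0).2 hdN
    split_ifs with h
    · omega
    · have h6 : N / d < 6 := by
        rw [Nat.div_lt_iff_lt_mul hd0]
        omega
      omega
  have comm (k : ℕ) : N / k / d = N / d / k := Nat.div_right_comm N k d
  rw [comm 2, comm 3, comm 5, comm 30]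
  have key' : (if d ≤ N / 6 then (0 : ℝ) else 1) ≤ ((N / d : ℕ) : ℝ) - ((N / d / 2 : ℕ) : ℝ)
      - ((N / d / 3 : ℕ) : ℝ) - ((N / d / 5 : ℕ) : ℝ) + ((N / d / 30 : ℕ) : ℝ) := by
    have : (((if d ≤ N / 6 then 0 else 1) + N / d / 2 + N / d / 3 + N / d / 5 : ℕ) : ℝ)
      ≤ ((N / d + N / d / 30 : ℕ) : ℝ) := Nat.cast_le.2 key
    simp only [Nat.cast_add, Nat.cast_ite, Nat.cast_zero, Nat.cast_one] at this
    linarith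
  have := mul_le_mul_of_nonneg_left key' hΛ
  split_ifs at this ⊢ <;> linarith

open Chebyshev in
theorem psi_sub_psi_div_six_le {N : ℕ} (hN : 30 ≤ N) :
    ψ (N : ℝ) - ψ ((N / 6 : ℕ) : ℝ) ≤ 0.9213 * N + 5 * Real.log N - 4.5 := by
  have hN' : (30 : ℝ) ≤ N := by exact_mod_cast hN
  have h0 := psi_sub_psi_div_six_le_log_factorial N
  have e (k : ℕ) : N / k = ⌊(N : ℝ) / k⌋₊ := by rw [Nat.floor_div_natCast, Nat.floor_natCast]
  have h1 := log_factorial_floor_le (y := N) (by linarith)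
  have h2 := le_log_factorial_floor (y := (N : ℝ) / (2 : ℕ)) (by push_cast; linarith)
  have h3 := le_log_factorial_floor (y := (N : ℝ) / (3 : ℕ)) (by push_cast; linarith)
  have h5 := le_log_factorial_floor (y := (N : ℝ) / (5 : ℕ)) (by push_cast; linarith)
  have h30 := log_factorial_floor_le (y := (N : ℝ) / (30 : ℕ)) (by push_cast; linarith)
  rw [← e, Real.log_div (by positivity) (by positivity)] at h2 h3 h5 h30
  rw [Nat.floor_natCast] at h1
  have l30 : Real.log 30 = Real.log 2 + Real.log 3 + Real.log 5 := by
    rw [← Real.log_mul (by norm_num) (by norm_num), ← Real.log_mul (by norm_num) (by norm_num)]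
    norm_num
  push_cast at h2 h3 h5 h30
  rw [l30] at h30
  have b2 := Real.log_two_lt_d9
  have b3 := Real.log_three_lt_d9
  have b5 := Real.log_five_lt_d9
  have c2 := Real.log_two_gt_d9
  have c3 := Real.log_three_gt_d9
  have c5 := Real.log_five_gt_d9
  have hA : (N : ℝ) * (14 / 30 * Real.log 2 + 9 / 30 * Real.log 3 + 5 / 30 * Real.log 5) ≤
      N * 0.9213 := mul_le_mul_of_nonneg_left (by linarith) (by linarith)
  nlinarith

open Chebyshev in
theorem psi_twenty_nine_le : ψ (29 : ℝ) ≤ 30 := by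
  have h := psi_eq_log_lcmUpto 29
  have hl : Nat.lcmUpto 29 = 2329089562800 := by decide +kernel
  rw [hl] at h
  push_cast at h
  rw [h]
  calc Real.log 2329089562800 ≤ Real.log (2 ^ 42) := Real.log_le_log (by norm_num) (by norm_num)
    _ = 42 * Real.log 2 := by rw [Real.log_pow]; norm_num
    _ ≤ 30 := by linarith [Real.log_two_lt_d9]

open Chebyshev in
theorem psi_le_mul_add_log_sq {N : ℕ} (hN : 1 ≤ N) :
    ψ (N : ℝ) ≤ 1.1056 * N + 1.4 * Real.log N ^ 2 + 30 := by
  induction N using Nat.strong_induction_on with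
  | _ N ih =>
    by_cases h : N < 30
    · have h29 : (N : ℝ) ≤ 29 := by exact_mod_cast Nat.le_of_lt_succ h
      have := psi_mono h29
      have := psi_twenty_nine_le
      have : (0 : ℝ) ≤ N := by positivity
      nlinarith [sq_nonneg (Real.log N)]
    · push Not at h
      have h1 : 1 ≤ N / 6 := by omega
      have hi := ih (N / 6) (by omega) h1
      have hs := psi_sub_psi_div_six_le h
      have hN' : (30 : ℝ) ≤ N := by exact_mod_cast h
      have hd : ((N / 6 : ℕ) : ℝ) ≤ N / 6 := Nat.cast_div_le
      have h1' : (1 : ℝ) ≤ ((N / 6 : ℕ) : ℝ) := by exact_mod_cast h1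
      have hl : Real.log ((N / 6 : ℕ) : ℝ) ≤ Real.log N - Real.log 6 := by
        rw [← Real.log_div (by positivity) (by positivity)]
        exact Real.log_le_log (by linarith) hd
      have hl0 := Real.log_nonneg h1'
      have hsq : Real.log ((N / 6 : ℕ) : ℝ) ^ 2 ≤ (Real.log N - Real.log 6) ^ 2 := by gcongr
      have l6 : Real.log 6 = Real.log 2 + Real.log 3 := by
        rw [← Real.log_mul (by norm_num) (by norm_num)]; norm_num
      have b2 := Real.log_two_lt_d9
      have b3 := Real.log_three_lt_d9
      have c2 := Real.log_two_gt_d9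
      have c3 := Real.log_three_gt_d9
      have g1 : 1.79175 ≤ Real.log 6 := by linarith
      have g2 : Real.log 6 ≤ 1.79177 := by linarith
      have g3 : 0 ≤ Real.log N := by linarith
      have g4 : Real.log 6 ^ 2 ≤ 1.79177 ^ 2 := by gcongr
      have g5 : 1.79175 * Real.log N ≤ Real.log 6 * Real.log N := by gcongr
      nlinarith

open Chebyshev in
theorem psi_le_of_ge {N : ℕ} (hN : 4096 ≤ N) : ψ (N : ℝ) ≤ 1.15 * N := by
  have hN' : (4096 : ℝ) ≤ N := by exact_mod_cast hN
  have h := psi_le_mul_add_log_sq (N := N) (by omega)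
  set r := √((N : ℝ) / 4096) with hr
  have hr2 : r ^ 2 = N / 4096 := Real.sq_sqrt (by positivity)
  have hr1 : 1 ≤ r := Real.one_le_sqrt.2 (by linarith)
  have hNr : (N : ℝ) = 2 ^ 12 * r ^ 2 := by rw [hr2]; ring
  have hlog : Real.log N = 12 * Real.log 2 + 2 * Real.log r := by
    rw [hNr, Real.log_mul (by positivity) (by positivity), Real.log_pow, Real.log_pow]
    norm_num
  have hlr := Real.log_le_sub_one_of_pos (x := r) (by linarith)
  have hle : Real.log N ≤ 6.32 + 2 * r := by linarith [Real.log_two_lt_d9]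
  have h0 : 0 ≤ Real.log N := Real.log_nonneg (by linarith)
  have hsq : Real.log N ^ 2 ≤ (6.32 + 2 * r) ^ 2 := by gcongr
  nlinarith

open Chebyshev in
theorem theta_le_of_ge {t : ℝ} (ht : 4096 ≤ t) : θ t ≤ 1.15 * t := by
  have h := psi_le_of_ge (N := ⌊t⌋₊) (Nat.le_floor (by exact_mod_cast ht))
  have h2 := theta_le_psi t
  rw [psi_eq_psi_coe_floor] at h2
  have := Nat.floor_le (a := t) (by linarith)
  linarith

theorem hasDerivAt_div_log_sq {t : ℝ} (ht : 1 < t) :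
    HasDerivAt (fun t : ℝ => t / Real.log t ^ 2)
      (1 / Real.log t ^ 2 - 2 / Real.log t ^ 3) t := by
  have hl : Real.log t ≠ 0 := (Real.log_pos ht).ne'
  have ht0 : t ≠ 0 := by linarith
  refine ((hasDerivAt_id' t).div ((Real.hasDerivAt_log ht0).pow 2)
    (pow_ne_zero 2 hl)).congr_deriv ?_
  simp only [Pi.pow_apply]
  field_simp
  norm_num
  ring

theorem log_ge_of_ge {t : ℝ} (ht : 4096 ≤ t) : 8 ≤ Real.log t := by
  calc (8 : ℝ) ≤ 12 * Real.log 2 := by linarith [Real.log_two_gt_d9]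
    _ = Real.log (2 ^ 12) := by rw [Real.log_pow]; norm_num
    _ ≤ Real.log t := Real.log_le_log (by norm_num) (by linarith)

theorem integral_one_div_log_sq_le {y : ℝ} (hy : 4096 ≤ y) :
    ∫ t in (4096 : ℝ)..y, 1 / Real.log t ^ 2 ≤ 4 / 3 * (y / Real.log y ^ 2) := by
  have hint (c : ℝ) (k : ℕ) :
      IntervalIntegrable (fun t => c / Real.log t ^ k) MeasureTheory.volume 4096 y := by
    refine ContinuousOn.intervalIntegrable fun t ht => ContinuousAt.continuousWithinAt ?_
    rw [Set.uIcc_of_le hy] at ht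
    have : t ≠ 0 := by linarith [ht.1]
    have : Real.log t ^ k ≠ 0 := pow_ne_zero _ (by linarith [log_ge_of_ge ht.1])
    fun_prop
  have hint' := (hint 1 2).sub (hint 2 3)
  have hFTC := intervalIntegral.integral_eq_sub_of_hasDerivAt
    (a := 4096) (b := y) (f := fun t : ℝ => t / Real.log t ^ 2)
    (f' := fun t => 1 / Real.log t ^ 2 - 2 / Real.log t ^ 3)
    (fun t ht => hasDerivAt_div_log_sq (by
      rw [Set.uIcc_of_le hy] at ht
      linarith [ht.1])) hint'
  calc ∫ t in (4096 : ℝ)..y, 1 / Real.log t ^ 2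
      ≤ ∫ t in (4096 : ℝ)..y, 4 / 3 * (1 / Real.log t ^ 2 - 2 / Real.log t ^ 3) := by
        refine intervalIntegral.integral_mono_on hy (hint 1 2) (hint'.const_mul _) fun t ht => ?_
        have hl := log_ge_of_ge ht.1
        have e : 4 / 3 * (1 / Real.log t ^ 2 - 2 / Real.log t ^ 3) - 1 / Real.log t ^ 2 =
            (Real.log t - 8) / (3 * Real.log t ^ 3) := by
          field_simp
          ring
        have : 0 ≤ (Real.log t - 8) / (3 * Real.log t ^ 3) :=
          div_nonneg (by linarith) (by positivity)
        linarith
    _ = 4 / 3 * (y / Real.log y ^ 2 - 4096 / Real.log 4096 ^ 2) := by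
        rw [intervalIntegral.integral_const_mul, hFTC]
    _ ≤ 4 / 3 * (y / Real.log y ^ 2) := by
        have : (0 : ℝ) ≤ 4096 / Real.log 4096 ^ 2 := by positivity
        linarith

open Chebyshev in
theorem primeCounting_floor_le {y : ℝ} (hy : 4096 ≤ y) :
    (Nat.primeCounting ⌊y⌋₊ : ℝ) ≤
      1.15 * (y / Real.log y) + 1.15 * (4 / 3 * (y / Real.log y ^ 2)) + 4096 := by
  have hl := log_ge_of_ge hy
  have hi (a : ℝ) (ha : 2 ≤ a) : IntervalIntegrable
      (fun t => θ t / (t * Real.log t ^ 2)) MeasureTheory.volume 2 a :=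
    (intervalIntegrable_iff_integrableOn_Icc_of_le ha).2 (integrableOn_theta_div_id_mul_log_sq a)
  have hi' := (hi 4096 (by norm_num)).symm.trans (hi y (by linarith))
  have h1 := primeCounting_eq_theta_div_log_add_integral (x := y) (by linarith)
  have h2 := primeCounting_eq_theta_div_log_add_integral (x := 4096) (by norm_num)
  rw [← intervalIntegral.integral_add_adjacent_intervals (hi 4096 (by norm_num)) hi'] at h1
  have h3 : 0 ≤ θ 4096 / Real.log 4096 :=
    div_nonneg (theta_nonneg _) (Real.log_nonneg (by norm_num))
  have h4 : (Nat.primeCounting ⌊(4096 : ℝ)⌋₊ : ℝ) ≤ 4096 := by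
    rw [Nat.floor_ofNat]
    have : Nat.primeCounting 4096 ≤ 4096 := by
      rw [← Nat.primesLE_card_eq_primeCounting, Nat.primesLE_eq_filter_Ioc_zero]
      exact (Finset.card_filter_le _ _).trans (by simp)
    exact_mod_cast this
  have h5 : θ y / Real.log y ≤ 1.15 * (y / Real.log y) := by
    rw [← mul_div_assoc]
    gcongr
    exact theta_le_of_ge hy
  have h6 : ∫ t in (4096 : ℝ)..y, θ t / (t * Real.log t ^ 2) ≤
      ∫ t in (4096 : ℝ)..y, 1.15 * (1 / Real.log t ^ 2) := by
    refine intervalIntegral.integral_mono_on hy hi'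
      ((intervalIntegrable_one_div_log_sq (by norm_num) (by linarith)).const_mul _) fun t ht => ?_
    have ht0 : 0 < t := by linarith [ht.1]
    have hlt := log_ge_of_ge ht.1
    calc θ t / (t * Real.log t ^ 2) ≤ 1.15 * t / (t * Real.log t ^ 2) := by
          gcongr
          exact theta_le_of_ge ht.1
      _ = 1.15 * (1 / Real.log t ^ 2) := by field_simp
  rw [intervalIntegral.integral_const_mul] at h6
  have h7 := integral_one_div_log_sq_le hy
  have h8 : ∫ t in (2 : ℝ)..4096, θ t / (t * Real.log t ^ 2) ≤ 4096 := by
    rw [h2] at h4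
    linarith only [h3, h4]
  rw [h1]
  linarith only [h5, h6, h7, h8]

theorem pi_half_upper_bound (x : ℝ) (hx : (2 : ℝ) ^ 24 < x) :
    (piR (x / 2) : ℝ) < 2 / 3 * x / Real.log x := by
  obtain ⟨y, rfl⟩ : ∃ y, x = 2 * y := ⟨x / 2, by ring⟩
  have hy : 2 ^ 23 < y := by norm_num at hx ⊢; linarith
  have hy0 : 0 < y := by linarith [show (0 : ℝ) < 2 ^ 23 by norm_num]
  rw [mul_div_cancel_left₀ y two_ne_zero, piR, Real.log_mul two_ne_zero hy0.ne']
  refine (primeCounting_floor_le (by norm_num at hy; linarith)).trans_lt ?_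
  have b2 := Real.log_two_lt_d9
  have c2 := Real.log_two_gt_d9
  have e23 : Real.log (2 ^ 23) = 23 * Real.log 2 := by rw [Real.log_pow]; norm_num
  have hL : 15.94 ≤ Real.log y := by
    have := Real.log_le_log (by norm_num) hy.le
    linarith
  have hLy : 4096 * Real.log y ≤ y / 128 := by
    have h := Real.log_le_sub_one_of_pos (x := y / 2 ^ 23) (by positivity)
    rw [Real.log_div hy0.ne' (by norm_num)] at h
    norm_num at h hy e23
    linarith
  set L := Real.log y
  have hL0 : 0 < L := by linarith
  have h4096 : 4096 ≤ y / 128 / L := by rwa [le_div_iff₀ hL0]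
  have hkey : (1.15 + 1 / 128) / L + 1.15 * (4 / 3) / L ^ 2 < 4 / 3 / (Real.log 2 + L) := by
    rw [div_add_div _ _ hL0.ne' (by positivity), div_lt_div_iff₀ (by positivity) (by positivity)]
    have hq : ((1.15 + 1 / 128) * L + 1.15 * (4 / 3)) * (Real.log 2 + L) < 4 / 3 * L ^ 2 := by
      have : ((1.15 + 1 / 128) * L + 1.15 * (4 / 3)) * (Real.log 2 + L) ≤
          ((1.15 + 1 / 128) * L + 1.15 * (4 / 3)) * (0.6932 + L) := by gcongr; linarith
      nlinarith
    have := mul_lt_mul_of_pos_left hq hL0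
    linarith
  calc 1.15 * (y / L) + 1.15 * (4 / 3 * (y / L ^ 2)) + 4096
      ≤ 1.15 * (y / L) + 1.15 * (4 / 3 * (y / L ^ 2)) + y / 128 / L := by gcongr
    _ = y * ((1.15 + 1 / 128) / L + 1.15 * (4 / 3) / L ^ 2) := by ring
    _ < y * (4 / 3 / (Real.log 2 + L)) := by gcongr
    _ = 2 / 3 * (2 * y) / (Real.log 2 + L) := by ring
end
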